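/- arXiv:2410.02419 — 3 statements merged into one kernel-verified Lean document; each statement's English description precedes it below -/
import Mathlib

section
/- Let 𝒜, ℬ and 𝒞 be abelian categories such that 𝒜 and ℬ have enough injectives, and let F : 𝒜 → ℬ and G : ℬ → 𝒞 be additive left exact functors. If F is exact and F sends every injective object of 𝒜 to a G-acyclic object of ℬ, then for every object A of 𝒜 and every i ≥ 0 there is a natural isomorphism Rⁱ(G ∘ F)(A) ≅ RⁱG(F(A)). -/
open CategoryTheory CategoryTheory.Limits

section

universe v u v' u'

variable {C : Type u} [Category.{v} C] [Abelian C] {D : Type u'} [Category.{v'} D] [Abelian D]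

namespace CochainComplex

section Coresolution

variable {Z : C} {K J : CochainComplex C ℕ} [∀ n, Injective (J.X n)]
  {j : Z ⟶ K.X 0} {w : j ≫ K.d 0 1 = 0}

/-- A morphism `Z ⟶ J.X 0` killed by the differential of a complex of injectives `J` extends to
any exact coresolution of `Z`. -/
theorem exists_hom_of_exact [Mono j] (h₀ : (ShortComplex.mk _ _ w).Exact)
    (h : ∀ n, (ShortComplex.mk _ _ (K.d_comp_d n (n + 1) (n + 2))).Exact)
    (g : Z ⟶ J.X 0) (hg : g ≫ J.d 0 1 = 0) :
    ∃ φ : K ⟶ J, j ≫ φ.f 0 = g := by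
  let φ₀ : K.X 0 ⟶ J.X 0 := Injective.factorThru g j
  have hφ₀ : j ≫ φ₀ = g := Injective.comp_factorThru g j
  have hz : j ≫ φ₀ ≫ J.d 0 1 = 0 := by rw [← Category.assoc, hφ₀, hg]
  let φ₁ : K.X 1 ⟶ J.X 1 := h₀.descToInjective (φ₀ ≫ J.d 0 1) hz
  have hφ₁ : K.d 0 1 ≫ φ₁ = φ₀ ≫ J.d 0 1 := h₀.comp_descToInjective _ hz
  refine ⟨mkHom K J φ₀ φ₁ hφ₁.symm fun n p ↦
    ⟨(h n).descToInjective (p.2.1 ≫ J.d (n + 1) (n + 2)) ?_, ?_⟩, ?_⟩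
  · change K.d n (n + 1) ≫ p.2.1 ≫ J.d (n + 1) (n + 2) = 0
    rw [← Category.assoc, ← p.2.2, Category.assoc, J.d_comp_d, comp_zero]
  · exact ((h n).comp_descToInjective _ _).symm
  · simpa using hφ₀

/-- A morphism from an exact coresolution of `Z` to a complex of injectives which vanishes on `Z`
is null-homotopic. -/
theorem nonempty_homotopy_zero_of_exact (h₀ : (ShortComplex.mk _ _ w).Exact)
    (h : ∀ n, (ShortComplex.mk _ _ (K.d_comp_d n (n + 1) (n + 2))).Exact)
    (φ : K ⟶ J) (hφ : j ≫ φ.f 0 = 0) : Nonempty (Homotopy φ 0) := by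
  let s₀ : K.X 1 ⟶ J.X 0 := h₀.descToInjective (φ.f 0) hφ
  have hs₀ : K.d 0 1 ≫ s₀ = φ.f 0 := h₀.comp_descToInjective _ hφ
  have hz : K.d 0 1 ≫ (φ.f 1 - s₀ ≫ J.d 0 1) = 0 := by
    rw [Preadditive.comp_sub, reassoc_of% hs₀, φ.comm, sub_self]
  let s₁ : K.X 2 ⟶ J.X 1 := (h 0).descToInjective (φ.f 1 - s₀ ≫ J.d 0 1) hz
  have hs₁ : K.d 1 2 ≫ s₁ = φ.f 1 - s₀ ≫ J.d 0 1 := (h 0).comp_descToInjective _ hz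
  have key (n : ℕ) (g : K.X (n + 1) ⟶ J.X n) (g' : K.X (n + 2) ⟶ J.X (n + 1))
      (hg : φ.f (n + 1) = g ≫ J.d n (n + 1) + K.d (n + 1) (n + 2) ≫ g') :
      ∃ g'' : K.X (n + 3) ⟶ J.X (n + 2),
        φ.f (n + 2) = g' ≫ J.d (n + 1) (n + 2) + K.d (n + 2) (n + 3) ≫ g'' := by
    have hz : K.d (n + 1) (n + 2) ≫ (φ.f (n + 2) - g' ≫ J.d (n + 1) (n + 2)) = 0 := by
      rw [Preadditive.comp_sub, ← φ.comm, hg, Preadditive.add_comp, Category.assoc,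
        Category.assoc, J.d_comp_d, comp_zero, zero_add, sub_self]
    refine ⟨(h (n + 1)).descToInjective _ hz, ?_⟩
    have hc : K.d (n + 2) (n + 3) ≫ (h (n + 1)).descToInjective _ hz = _ :=
      (h (n + 1)).comp_descToInjective _ hz
    rw [hc]
    abel
  exact ⟨Homotopy.mkCoinductive φ s₀ hs₀.symm s₁ (by rw [hs₁]; abel) fun n p ↦
    ⟨(key n p.1 p.2.1 p.2.2).choose, (key n p.1 p.2.1 p.2.2).choose_spec⟩⟩

/-- Two morphisms from an exact coresolution of `Z` to a complex of injectives which agree on `Z`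
are homotopic. -/
theorem nonempty_homotopy_of_exact (h₀ : (ShortComplex.mk _ _ w).Exact)
    (h : ∀ n, (ShortComplex.mk _ _ (K.d_comp_d n (n + 1) (n + 2))).Exact)
    (φ ψ : K ⟶ J) (hφ : j ≫ φ.f 0 = j ≫ ψ.f 0) : Nonempty (Homotopy φ ψ) :=
  (nonempty_homotopy_zero_of_exact h₀ h (φ - ψ)
    (by simp [hφ])).map fun s ↦ Homotopy.equivSubZero.symm s

end Coresolution

/-- The contractible complex with `U n ⊞ U (n + 1)` in degree `n`, and whose differential
identifies the second summand in degree `n` with the first one in degree `n + 1`. -/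
noncomputable def disks (U : ℕ → C) : CochainComplex C ℕ :=
  CochainComplex.of (fun n ↦ U n ⊞ U (n + 1)) (fun _ ↦ biprod.snd ≫ biprod.inl) (by simp)

namespace disks

variable (U : ℕ → C)

/-- The projection on the first summand. -/
noncomputable def fst (n : ℕ) : (disks U).X n ⟶ U n :=
  (biprod.fst : U n ⊞ U (n + 1) ⟶ U n)

/-- The projection on the second summand. -/
noncomputable def snd (n : ℕ) : (disks U).X n ⟶ U (n + 1) :=
  (biprod.snd : U n ⊞ U (n + 1) ⟶ U (n + 1))

/-- The inclusion of the first summand. -/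
noncomputable def inl (n : ℕ) : U n ⟶ (disks U).X n :=
  (biprod.inl : U n ⟶ U n ⊞ U (n + 1))

/-- The inclusion of the second summand. -/
noncomputable def inr (n : ℕ) : U (n + 1) ⟶ (disks U).X n :=
  (biprod.inr : U (n + 1) ⟶ U n ⊞ U (n + 1))

@[simp]
lemma inl_fst (n : ℕ) : inl U n ≫ fst U n = 𝟙 _ := biprod.inl_fst

@[simp]
lemma inl_snd (n : ℕ) : inl U n ≫ snd U n = 0 := biprod.inl_snd

@[simp]
lemma inr_fst (n : ℕ) : inr U n ≫ fst U n = 0 := biprod.inr_fst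

@[simp]
lemma inr_snd (n : ℕ) : inr U n ≫ snd U n = 𝟙 _ := biprod.inr_snd

@[simp]
lemma inl_fst_assoc (n : ℕ) {Z : C} (f : U n ⟶ Z) : inl U n ≫ fst U n ≫ f = f :=
  biprod.inl_fst_assoc f

@[simp]
lemma inl_snd_assoc (n : ℕ) {Z : C} (f : U (n + 1) ⟶ Z) : inl U n ≫ snd U n ≫ f = 0 :=
  (biprod.inl_snd_assoc f).trans zero_comp

@[simp]
lemma inr_snd_assoc (n : ℕ) {Z : C} (f : U (n + 1) ⟶ Z) : inr U n ≫ snd U n ≫ f = f :=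
  biprod.inr_snd_assoc f

lemma total (n : ℕ) : fst U n ≫ inl U n + snd U n ≫ inr U n = 𝟙 _ := biprod.total

lemma d_eq (n : ℕ) : (disks U).d n (n + 1) = snd U n ≫ inl U (n + 1) :=
  CochainComplex.of_d (fun n ↦ U n ⊞ U (n + 1)) (fun _ ↦ biprod.snd ≫ biprod.inl) n

instance [∀ n, Injective (U n)] (n : ℕ) : Injective ((disks U).X n) :=
  inferInstanceAs (Injective (U n ⊞ U (n + 1)))

/-- If `U 0` is a zero object, then `disks U` is contractible. -/
theorem nonempty_homotopy_id (h₀ : IsZero (U 0)) :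
    Nonempty (Homotopy (𝟙 (disks U)) 0) := by
  have e : 𝟙 (disks U) = Homotopy.nullHomotopicMap' (fun
    | _, j, rfl => fst U (j + 1) ≫ inr U j) := by
    ext n
    cases n with
    | zero =>
      rw [Homotopy.nullHomotopicMap'_f_of_not_rel_right (k₁ := 0) (k₀ := 1)
        (c := ComplexShape.up ℕ) rfl (by simp), d_eq]
      have hz : fst U 0 = 0 := h₀.eq_of_tgt _ _
      simpa [hz] using (total U 0).symm
    | succ n =>
      rw [Homotopy.nullHomotopicMap'_f (k₂ := n) (k₁ := n + 1) (k₀ := n + 2)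
        (c := ComplexShape.up ℕ) rfl rfl, d_eq, d_eq]
      simpa [add_comm] using (total U (n + 1)).symm
  exact ⟨(Homotopy.ofEq e).trans (Homotopy.nullHomotopy' _)⟩

variable {K : CochainComplex C ℕ}

/-- The morphism to `disks U` induced by morphisms in each degree. -/
noncomputable def lift (j : ∀ n, K.X n ⟶ U n) : K ⟶ disks U where
  f n := j n ≫ inl U n + K.d n (n + 1) ≫ j (n + 1) ≫ inr U n
  comm' n _ h := by
    obtain rfl : n + 1 = _ := h
    simp [d_eq]

lemma lift_f (j : ∀ n, K.X n ⟶ U n) (n : ℕ) :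
    (lift U j).f n = j n ≫ inl U n + K.d n (n + 1) ≫ j (n + 1) ≫ inr U n := rfl

lemma lift_f_fst (j : ∀ n, K.X n ⟶ U n) (n : ℕ) :
    (lift U j).f n ≫ fst U n = j n := by
  simp [lift_f]

lemma lift_f_snd (j : ∀ n, K.X n ⟶ U n) (n : ℕ) :
    (lift U j).f n ≫ snd U n = K.d n (n + 1) ≫ j (n + 1) := by
  simp [lift_f]

end disks

/-- The projection `J ⊞ L ⟶ J` is a homotopy equivalence when `L` is contractible. -/
noncomputable def biprodFstHomotopyEquiv (J L : CochainComplex C ℕ) (h : Homotopy (𝟙 L) 0) :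
    HomotopyEquiv (J ⊞ L) J where
  hom := biprod.fst
  inv := biprod.inl
  homotopyHomInvId := by
    have h' : Homotopy (biprod.snd ≫ biprod.inr) (0 : J ⊞ L ⟶ J ⊞ L) :=
      (Homotopy.ofEq (by simp)).trans
        (((h.compLeft biprod.snd).compRight biprod.inr).trans (Homotopy.ofEq (by simp)))
    exact (Homotopy.ofEq (add_zero _).symm).trans
      (((Homotopy.refl (biprod.fst ≫ biprod.inl)).add h'.symm).trans (Homotopy.ofEq biprod.total))
  homotopyInvHomId := Homotopy.ofEq biprod.inl_fst

instance injective_biprod_X (J L : CochainComplex C ℕ) [∀ n, Injective (J.X n)]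
    [∀ n, Injective (L.X n)] (n : ℕ) : Injective ((J ⊞ L).X n) :=
  Injective.of_iso (HomologicalComplex.biprodXIso J L n).symm inferInstance

/-- If `j : Z ⟶ K.X 0` is a kernel of `K.d 0 1` and `j ≫ φ.f 0` is a monomorphism, then `φ.f 0`
is a monomorphism on the kernel of `K.d 0 1`. -/
theorem eq_zero_of_exact_of_mono {K J : CochainComplex C ℕ} {Z : C} {j : Z ⟶ K.X 0}
    {w : j ≫ K.d 0 1 = 0} (h₀ : (ShortComplex.mk _ _ w).Exact) (φ : K ⟶ J)
    [Mono (j ≫ φ.f 0)] ⦃T : C⦄ (x : T ⟶ K.X 0) (hx : x ≫ K.d 0 1 = 0)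
    (hx' : x ≫ φ.f 0 = 0) : x = 0 := by
  have : Mono j := mono_of_mono j (φ.f 0)
  obtain ⟨l, hl⟩ : ∃ l : T ⟶ Z, l ≫ j = x := ⟨h₀.lift x hx, h₀.lift_f x hx⟩
  have hl' : l ≫ j ≫ φ.f 0 = 0 := by rw [← Category.assoc, hl, hx']
  rw [← hl, zero_of_comp_mono (j ≫ φ.f 0) hl', zero_comp]

open scoped ZeroObject in
/-- A morphism `φ : K ⟶ J` to a complex of injectives becomes a monomorphism after replacing `J`
by a homotopy equivalent complex of injectives, provided that `φ.f 0` is a monomorphism on the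
kernel of `K.d 0 1`. -/
theorem exists_mono_comp_homotopyEquiv [EnoughInjectives C] {K J : CochainComplex C ℕ}
    [∀ n, Injective (J.X n)] (φ : K ⟶ J)
    (hφ : ∀ ⦃T : C⦄ (x : T ⟶ K.X 0), x ≫ K.d 0 1 = 0 → x ≫ φ.f 0 = 0 → x = 0) :
    ∃ (J' : CochainComplex C ℕ) (i : K ⟶ J') (p : HomotopyEquiv J' J),
      (∀ n, Injective (J'.X n)) ∧ Mono i ∧ i ≫ p.hom = φ ∧
        ∀ ⦃T : C⦄ (x : T ⟶ K.X 0), x ≫ K.d 0 1 = 0 →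
          x ≫ i.f 0 = x ≫ φ.f 0 ≫ p.inv.f 0 := by
  obtain ⟨U, j, hU, hU₀, hj⟩ : ∃ (U : ℕ → C) (j : ∀ n, K.X n ⟶ U n),
      (∀ n, Injective (U n)) ∧ IsZero (U 0) ∧ ∀ n, Mono (j (n + 1)) :=
    ⟨fun | 0 => 0 | n + 1 => Injective.under (K.X (n + 1)),
      fun | 0 => 0 | n + 1 => Injective.ι (K.X (n + 1)),
      fun
        | 0 => (isZero_zero C).injective
        | n + 1 => inferInstanceAs (Injective (Injective.under _)),
      isZero_zero C, fun n ↦ inferInstanceAs (Mono (Injective.ι _))⟩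
  have hj₀ : j 0 = 0 := hU₀.eq_of_tgt _ _
  obtain ⟨h⟩ := disks.nonempty_homotopy_id U hU₀
  let i : K ⟶ J ⊞ disks U := φ ≫ biprod.inl + disks.lift U j ≫ biprod.inr
  have hi (n : ℕ) : i.f n ≫ (biprod.fst : J ⊞ disks U ⟶ J).f n = φ.f n := by
    rw [← HomologicalComplex.comp_f]
    simp [i]
  have hi' (n : ℕ) : i.f n ≫ (biprod.snd : J ⊞ disks U ⟶ _).f n = (disks.lift U j).f n := by
    rw [← HomologicalComplex.comp_f]
    simp [i]
  refine ⟨J ⊞ disks U, i, biprodFstHomotopyEquiv _ _ h, fun n ↦ inferInstance, ?_, ?_, ?_⟩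
  · have (n : ℕ) : Mono (i.f n) := by
      refine Preadditive.mono_of_cancel_zero _ fun {T} x hx ↦ ?_
      have h₁ : x ≫ φ.f n = 0 := by rw [← hi, reassoc_of% hx, zero_comp]
      have h₂ : x ≫ (disks.lift U j).f n = 0 := by rw [← hi', reassoc_of% hx, zero_comp]
      cases n with
      | zero =>
        refine hφ x ?_ h₁
        have := hj 0
        rw [← cancel_mono (j 1), Category.assoc, ← disks.lift_f_snd, reassoc_of% h₂, zero_comp,
          zero_comp]
      | succ n =>
        have := hj n
        have h₃ : x ≫ j (n + 1) = 0 := by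
          rw [← disks.lift_f_fst U j, reassoc_of% h₂, zero_comp]
        rw [← cancel_mono (j (n + 1)), h₃, zero_comp]
    exact HomologicalComplex.mono_of_mono_f i this
  · simp [i, biprodFstHomotopyEquiv]
  · intro T x hx
    simp [i, biprodFstHomotopyEquiv, disks.lift_f, hj₀, reassoc_of% hx]

end CochainComplex

namespace CategoryTheory

namespace ShortComplex.ShortExact

/-- A short exact sequence is resolved by a degreewise split short exact sequence of injective
resolutions. -/
theorem exists_injectiveResolutions [EnoughInjectives C] {S : ShortComplex C}
    (hS : S.ShortExact) :
    ∃ (R₁ : InjectiveResolution S.X₁) (R₂ : InjectiveResolution S.X₂)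
      (R₃ : InjectiveResolution S.X₃) (i : R₁.cocomplex ⟶ R₂.cocomplex)
      (p : R₂.cocomplex ⟶ R₃.cocomplex) (w : i ≫ p = 0),
      (ShortComplex.mk i p w).ShortExact ∧ R₂.ι.f 0 ≫ p.f 0 = S.g ≫ R₃.ι.f 0 := by
  have := hS.mono_f
  obtain ⟨R₁⟩ : Nonempty (InjectiveResolution S.X₁) := ⟨injectiveResolution _⟩
  obtain ⟨R⟩ : Nonempty (InjectiveResolution S.X₂) := ⟨injectiveResolution _⟩
  let φ := InjectiveResolution.desc S.f R R₁
  have hφ : R₁.ι.f 0 ≫ φ.f 0 = S.f ≫ R.ι.f 0 :=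
    InjectiveResolution.desc_commutes_zero S.f R R₁
  have hm : Mono (R₁.ι.f 0 ≫ φ.f 0) := by
    rw [hφ]
    have : Mono (R.ι.f 0) := inferInstance
    exact mono_comp' hS.mono_f this
  obtain ⟨J, i, e, hJ, hi, -, hie⟩ := CochainComplex.exists_mono_comp_homotopyEquiv φ
    (CochainComplex.eq_zero_of_exact_of_mono R₁.exact₀ φ)
  let R₂ : InjectiveResolution S.X₂ := { cocomplex := J, ι := R.ι ≫ e.inv }
  let T := ShortComplex.mk i (cokernel.π i) (cokernel.condition i)
  have hT : T.ShortExact :=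
    { exact := ShortComplex.exact_cokernel i
      mono_f := hi
      epi_g := inferInstanceAs (Epi (cokernel.π i)) }
  let S' := S.map (CochainComplex.single₀ C)
  have hS' : S'.ShortExact := hS.map_of_exact _
  have comm : R₁.ι ≫ i = (CochainComplex.single₀ C).map S.f ≫ R₂.ι := by
    apply HomologicalComplex.from_single_hom_ext
    have := hie (R₁.ι.f 0) R₁.ι_f_zero_comp_complex_d
    rw [reassoc_of% hφ] at this
    rw [HomologicalComplex.comp_f, this, HomologicalComplex.comp_f,
      CochainComplex.single₀_map_f_zero]
    exact Category.assoc _ _ _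
  have comm' : (CochainComplex.single₀ C).map S.f ≫ R₂.ι ≫ T.g = 0 := by
    rw [← Category.assoc, ← comm, Category.assoc, T.zero, comp_zero]
  have := hS'.epi_g
  let τ₃ : (CochainComplex.single₀ C).obj S.X₃ ⟶ T.X₃ := hS'.exact.desc (R₂.ι ≫ T.g) comm'
  have hτ₃ : (CochainComplex.single₀ C).map S.g ≫ τ₃ = R₂.ι ≫ T.g :=
    hS'.exact.g_desc _ comm'
  let τ : S' ⟶ T :=
    { τ₁ := R₁.ι
      τ₂ := R₂.ι
      τ₃ := τ₃
      comm₁₂ := comm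
      comm₂₃ := hτ₃.symm }
  have : _root_.QuasiIso τ₃ := HomologicalComplex.HomologySequence.quasiIso_τ₃ τ hS' hT
    R₁.quasiIso R₂.quasiIso
  have hinj (n : ℕ) : Injective (T.X₃.X n) := by
    have hn : (T.map (HomologicalComplex.eval C _ n)).ShortExact := hT.map_of_exact _
    have : Injective (T.map (HomologicalComplex.eval C _ n)).X₁ := R₁.injective n
    let r : Retract (T.X₃.X n) (J.X n) :=
      { i := hn.splittingOfInjective.s
        r := T.g.f n
        retract := hn.splittingOfInjective.s_g }
    exact r.injective
  let R₃ : InjectiveResolution S.X₃ := { cocomplex := T.X₃, ι := τ₃ }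
  refine ⟨R₁, R₂, R₃, i, T.g, T.zero, hT, ?_⟩
  have := HomologicalComplex.congr_hom hτ₃ 0
  rw [HomologicalComplex.comp_f, CochainComplex.single₀_map_f_zero] at this
  exact this.symm

/-- The image under an additive functor of a short exact sequence of complexes is short exact as
soon as it is so in each degree. -/
theorem map_mapHomologicalComplex {ι : Type*} {c : ComplexShape ι}
    {T : ShortComplex (HomologicalComplex C c)} (G : C ⥤ D) [G.Additive]
    (h : ∀ n, ((T.map (HomologicalComplex.eval C c n)).map G).ShortExact) :
    (T.map (G.mapHomologicalComplex c)).ShortExact :=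
  HomologicalComplex.shortExact_of_degreewise_shortExact _ h

theorem map_mapHomologicalComplex_of_injective {ι : Type*} {c : ComplexShape ι}
    {T : ShortComplex (HomologicalComplex C c)} (G : C ⥤ D) [G.Additive]
    (hT : T.ShortExact) (h : ∀ n, Injective (T.X₁.X n)) :
    (T.map (G.mapHomologicalComplex c)).ShortExact :=
  map_mapHomologicalComplex G fun n ↦ by
    have hn : (T.map (HomologicalComplex.eval C _ n)).ShortExact := hT.map_of_exact _
    have : Injective (T.map (HomologicalComplex.eval C _ n)).X₁ := h n
    exact (hn.splittingOfInjective.map G).shortExact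

variable [EnoughInjectives C] {S : ShortComplex C} (G : C ⥤ D) [G.Additive]

theorem isZero_rightDerived_X₃ (hS : S.ShortExact) (n : ℕ)
    (h₂ : IsZero ((G.rightDerived n).obj S.X₂))
    (h₁ : IsZero ((G.rightDerived (n + 1)).obj S.X₁)) :
    IsZero ((G.rightDerived n).obj S.X₃) := by
  obtain ⟨R₁, R₂, R₃, i, p, w, hT, -⟩ := hS.exists_injectiveResolutions
  have hGT := map_mapHomologicalComplex_of_injective G hT R₁.injective
  exact ((hGT.homology_exact₃ n (n + 1) rfl).isZero_X₂
    ((h₂.of_iso (R₂.isoRightDerivedObj G n).symm).eq_of_src _ _)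
    ((h₁.of_iso (R₁.isoRightDerivedObj G (n + 1)).symm).eq_of_tgt _ _)).of_iso
      (R₃.isoRightDerivedObj G n)

theorem epi_map_g [PreservesFiniteLimits G] (hS : S.ShortExact)
    (h₁ : IsZero ((G.rightDerived 1).obj S.X₁)) :
    Epi (G.map S.g) := by
  obtain ⟨R₁, R₂, R₃, i, p, w, hT, hp⟩ := hS.exists_injectiveResolutions
  have hGT := map_mapHomologicalComplex_of_injective G hT R₁.injective
  have : Epi (HomologicalComplex.homologyMap ((G.mapHomologicalComplex _).map p) 0) :=
    (hGT.homology_exact₃ 0 1 rfl).epi_f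
      ((h₁.of_iso (R₁.isoRightDerivedObj G 1).symm).eq_of_tgt _ _)
  have h := InjectiveResolution.isoRightDerivedObj_hom_naturality S.g R₂ R₃ p hp G 0
  have h₀ : Epi ((G.rightDerived 0).map S.g) :=
    ((MorphismProperty.epimorphisms D).arrow_mk_iso_iff (Arrow.isoMk
      (R₂.isoRightDerivedObj G 0) (R₃.isoRightDerivedObj G 0) h.symm)).2 this
  exact ((MorphismProperty.epimorphisms D).arrow_mk_iso_iff (Arrow.isoMk
    (G.rightDerivedZeroIsoSelf.app S.X₂) (G.rightDerivedZeroIsoSelf.app S.X₃)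
      (G.rightDerivedZeroIsoSelf.hom.naturality S.g).symm)).1 h₀

end ShortComplex.ShortExact

end CategoryTheory

namespace CochainComplex

variable {K : CochainComplex C ℕ}

/-- In an acyclic complex, the cycles form short exact sequences with the terms. -/
theorem shortExact_cycles (hK : K.Acyclic) (n : ℕ) :
    (ShortComplex.mk (K.iCycles n) (K.toCycles n (n + 1)) (by
      rw [← cancel_mono (K.iCycles (n + 1))]; simp)).ShortExact where
  mono_f := inferInstanceAs (Mono (K.iCycles n))
  epi_g := by
    exact Preadditive.epi_of_isZero_cokernel' _ (K.homologyIsCokernel n (n + 1) (by simp))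
      ((K.exactAt_iff_isZero_homology _).1 (hK (n + 1)))
  exact := by
    let S := ShortComplex.mk (K.iCycles n) (K.d n (n + 1)) (K.iCycles_d n (n + 1))
    have hS : S.Exact := ShortComplex.exact_of_f_is_kernel _ (K.cyclesIsKernel n (n + 1) (by simp))
    let φ : ShortComplex.mk (K.iCycles n) (K.toCycles n (n + 1)) (by
        rw [← cancel_mono (K.iCycles (n + 1))]; simp) ⟶ S :=
      { τ₁ := 𝟙 _
        τ₂ := 𝟙 _
        τ₃ := K.iCycles (n + 1) }
    have : Epi φ.τ₁ := inferInstanceAs (Epi (𝟙 _))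
    have : IsIso φ.τ₂ := inferInstanceAs (IsIso (𝟙 _))
    have : Mono φ.τ₃ := inferInstanceAs (Mono (K.iCycles _))
    exact (ShortComplex.exact_iff_of_epi_of_isIso_of_mono φ).2 hS

theorem isZero_cycles_zero (hK : K.Acyclic) : IsZero (K.cycles 0) :=
  ((K.exactAt_iff_isZero_homology 0).1 (hK 0)).of_iso K.isoHomologyπ₀

variable [EnoughInjectives C] (G : C ⥤ D) [G.Additive]

theorem isZero_rightDerived_cycles (hK : K.Acyclic)
    (h : ∀ n k, IsZero ((G.rightDerived (k + 1)).obj (K.X n))) (n k : ℕ) :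
    IsZero ((G.rightDerived (k + 1)).obj (K.cycles n)) := by
  induction n generalizing k with
  | zero =>
    have := (isZero_cycles_zero hK).injective
    exact G.isZero_rightDerived_obj_injective_succ k _
  | succ n ih =>
    exact (shortExact_cycles hK n).isZero_rightDerived_X₃ G (k + 1) (h n k) (ih (k + 1))

/-- A left exact functor `G` preserves acyclicity of bounded below complexes
of `G`-acyclic objects. -/
theorem acyclic_mapHomologicalComplex [PreservesFiniteLimits G] (hK : K.Acyclic)
    (h : ∀ n k, IsZero ((G.rightDerived (k + 1)).obj (K.X n))) :
    ((G.mapHomologicalComplex (ComplexShape.up ℕ)).obj K).Acyclic := by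
  have hepi (n : ℕ) : Epi (G.map (K.toCycles n (n + 1))) :=
    (shortExact_cycles hK n).epi_map_g G (isZero_rightDerived_cycles G hK h n 0)
  have hker (n : ℕ) : (ShortComplex.mk (G.map (K.iCycles n)) (G.map (K.d n (n + 1)))
      (by rw [← G.map_comp, K.iCycles_d, G.map_zero])).Exact := by
    let S := ShortComplex.mk (K.iCycles n) (K.d n (n + 1)) (K.iCycles_d n (n + 1))
    have hS : S.Exact := ShortComplex.exact_of_f_is_kernel _ (K.cyclesIsKernel n (n + 1) (by simp))
    have : Mono S.f := inferInstanceAs (Mono (K.iCycles n))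
    exact hS.map_of_mono_of_preservesKernel G inferInstance inferInstance
  intro n
  cases n with
  | zero =>
    rw [HomologicalComplex.exactAt_iff' _ 0 0 1 (by simp) (by simp)]
    have : Mono (G.map (K.d 0 1)) :=
      (hker 0).mono_g ((G.map_isZero (isZero_cycles_zero hK)).eq_of_src _ _)
    exact (ShortComplex.exact_iff_mono _
      (((G.mapHomologicalComplex _).obj K).shape 0 0 (Nat.succ_ne_zero 0))).2 this
  | succ n =>
    rw [HomologicalComplex.exactAt_iff' _ n (n + 1) (n + 2) (by simp) (by simp)]
    have : G.map (K.toCycles n (n + 1)) ≫ G.map (K.iCycles (n + 1)) = G.map (K.d n (n + 1)) := by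
      rw [← G.map_comp, K.toCycles_i]
    let φ : ((G.mapHomologicalComplex (ComplexShape.up ℕ)).obj K).sc' n (n + 1) (n + 2) ⟶
        ShortComplex.mk (G.map (K.iCycles (n + 1))) (G.map (K.d (n + 1) (n + 2)))
          (by rw [← G.map_comp, K.iCycles_d, G.map_zero]) :=
      { τ₁ := G.map (K.toCycles n (n + 1))
        τ₂ := 𝟙 _
        τ₃ := 𝟙 _
        comm₁₂ := this.trans (Category.comp_id _).symm
        comm₂₃ := (Category.id_comp _).trans (Category.comp_id _).symm }
    have : Epi φ.τ₁ := hepi n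
    have : IsIso φ.τ₂ := inferInstanceAs (IsIso (𝟙 _))
    have : Mono φ.τ₃ := inferInstanceAs (Mono (𝟙 _))
    exact (ShortComplex.exact_iff_of_epi_of_isIso_of_mono φ).2 (hker (n + 1))

end CochainComplex

namespace CategoryTheory.ShortComplex.ShortExact

/-- In a short exact sequence of complexes with acyclic cokernel, the monomorphism is a
quasi-isomorphism. -/
theorem quasiIso_f {ι : Type*} {c : ComplexShape ι} {S : ShortComplex (HomologicalComplex C c)}
    (hS : S.ShortExact) (h₃ : S.X₃.Acyclic) : _root_.QuasiIso S.f := by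
  have hz (j : ι) : IsZero (S.X₃.homology j) := (S.X₃.exactAt_iff_isZero_homology j).1 (h₃ j)
  refine ⟨fun j ↦ ?_⟩
  rw [quasiIsoAt_iff_isIso_homologyMap]
  have : Epi (HomologicalComplex.homologyMap S.f j) :=
    (hS.homology_exact₂ j).epi_f ((hz j).eq_of_tgt _ _)
  have : Mono (HomologicalComplex.homologyMap S.f j) := by
    by_cases! hj : ∃ i, c.Rel i j
    · obtain ⟨i, hij⟩ := hj
      exact (hS.homology_exact₁ i j hij).mono_g ((hz i).eq_of_src _ _)
    · have := hS.mono_f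
      exact HomologicalComplex.mono_homologyMap_of_mono_of_not_rel S.f j hj
  exact isIso_of_mono_of_epi _

end CategoryTheory.ShortComplex.ShortExact

namespace CochainComplex

/-- A left exact functor `G` preserves quasi-isomorphisms from a complex of `G`-acyclic objects
to a complex of injective objects, provided that they are monomorphisms on `0`-cycles. -/
theorem quasiIso_map_of_injective [EnoughInjectives C] (G : C ⥤ D) [G.Additive]
    [PreservesFiniteLimits G] {K J : CochainComplex C ℕ} [∀ n, Injective (J.X n)] (φ : K ⟶ J)
    [QuasiIso φ]
    (hφ : ∀ ⦃T : C⦄ (x : T ⟶ K.X 0), x ≫ K.d 0 1 = 0 → x ≫ φ.f 0 = 0 → x = 0)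
    (hK : ∀ n k, IsZero ((G.rightDerived (k + 1)).obj (K.X n))) :
    QuasiIso ((G.mapHomologicalComplex (ComplexShape.up ℕ)).map φ) := by
  obtain ⟨J', i, e, hJ', hi, rfl, -⟩ := exists_mono_comp_homotopyEquiv φ hφ
  have : QuasiIso i := quasiIso_of_comp_right i e.hom
  let T := ShortComplex.mk i (cokernel.π i) (cokernel.condition i)
  have hT : T.ShortExact :=
    { exact := ShortComplex.exact_cokernel i
      mono_f := hi
      epi_g := inferInstanceAs (Epi (cokernel.π i)) }
  have hTn (n : ℕ) : (T.map (HomologicalComplex.eval C _ n)).ShortExact := hT.map_of_exact _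
  have hQ : T.X₃.Acyclic := hT.acyclic_X₃ this
  have hGQ := acyclic_mapHomologicalComplex G hQ fun n k ↦
    (hTn n).isZero_rightDerived_X₃ G (k + 1)
      (have := hJ' n; G.isZero_rightDerived_obj_injective_succ k (J'.X n)) (hK n (k + 1))
  have hGT : (T.map (G.mapHomologicalComplex _)).ShortExact :=
    ShortComplex.ShortExact.map_mapHomologicalComplex G fun n ↦
      { exact := (hTn n).exact.map_of_mono_of_preservesKernel G (hTn n).mono_f inferInstance
        mono_f := have := (hTn n).mono_f; inferInstanceAs (Mono (G.map (i.f n)))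
        epi_g := (hTn n).epi_map_g G (hK n 0) }
  have : QuasiIso ((G.mapHomologicalComplex (ComplexShape.up ℕ)).map i) :=
    hGT.quasiIso_f hGQ
  rw [Functor.map_comp]
  have : QuasiIso ((G.mapHomologicalComplex (ComplexShape.up ℕ)).map e.hom) :=
    inferInstanceAs (QuasiIso (G.mapHomotopyEquiv e).hom)
  infer_instance

end CochainComplex

namespace CategoryTheory.InjectiveResolution

variable {X : C} (I : InjectiveResolution X) (F : C ⥤ D) [F.Additive]

lemma map_ι_f_zero_comp_map_d :
    F.map (I.ι.f 0) ≫ ((F.mapHomologicalComplex _).obj I.cocomplex).d 0 1 = 0 :=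
  (F.map_comp _ _).symm.trans
    ((congrArg F.map I.ι_f_zero_comp_complex_d).trans (F.map_zero _ _))

variable [PreservesFiniteLimits F] [PreservesFiniteColimits F]

lemma exact₀_map : (ShortComplex.mk (F.map (I.ι.f 0)) _ (I.map_ι_f_zero_comp_map_d F)).Exact :=
  I.exact₀.map F

lemma exact_succ_map (n : ℕ) :
    (ShortComplex.mk _ _ (((F.mapHomologicalComplex _).obj I.cocomplex).d_comp_d
      n (n + 1) (n + 2))).Exact :=
  (I.exact_succ n).map F

/-- The image under an exact functor `F` of an injective resolution of `X` is quasi-isomorphic to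
any injective resolution of `F.obj X`, via a morphism compatible with the coaugmentations. -/
theorem exists_quasiIso_of_exact (J : InjectiveResolution (F.obj X)) :
    ∃ φ : (F.mapHomologicalComplex _).obj I.cocomplex ⟶ J.cocomplex,
      F.map (I.ι.f 0) ≫ φ.f 0 = J.ι.f 0 ∧ QuasiIso φ := by
  have hm : Mono (I.ι.f 0) := inferInstance
  obtain ⟨φ, hφ⟩ := @CochainComplex.exists_hom_of_exact _ _ _ _ _ _ _ _ _
    (F.map_mono (I.ι.f 0)) (I.exact₀_map F) (I.exact_succ_map F)
    (J.ι.f 0) J.ι_f_zero_comp_complex_d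
  refine ⟨φ, hφ, ?_⟩
  let e := (HomologicalComplex.singleMapHomologicalComplex F (ComplexShape.up ℕ) 0).app X
  have he : e.inv ≫ (F.mapHomologicalComplex _).map I.ι ≫ φ = J.ι := by
    apply HomologicalComplex.from_single_hom_ext
    have h₀ : e.inv.f 0 = 𝟙 (F.obj X) :=
      (HomologicalComplex.singleMapHomologicalComplex_inv_app_self F _ 0 X).trans (by
        dsimp [HomologicalComplex.singleObjXSelf, HomologicalComplex.singleObjXIsoOfEq]
        simp
        rfl)
    change e.inv.f 0 ≫ F.map (I.ι.f 0) ≫ φ.f 0 = J.ι.f 0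
    rw [h₀]
    exact (Category.id_comp _).trans hφ
  have : QuasiIso ((F.mapHomologicalComplex (ComplexShape.up ℕ)).map I.ι) := inferInstance
  have h' : QuasiIso ((F.mapHomologicalComplex (ComplexShape.up ℕ)).map I.ι ≫ φ) :=
    (quasiIso_iff_comp_left e.inv _).1 (he ▸ J.quasiIso)
  exact quasiIso_of_comp_left ((F.mapHomologicalComplex (ComplexShape.up ℕ)).map I.ι) φ

end CategoryTheory.InjectiveResolution

end

namespace CategoryTheory

lemma isoTrans_naturality {C : Type*} [Category* C] {P P' Q Q' R R' S S' : C} {r : P ⟶ P'}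
    {q : Q ⟶ Q'} {t : R ⟶ R'} {u : S ⟶ S'} {α : P ≅ Q} {α' : P' ≅ Q'} (ε : Q ≅ R) (ε' : Q' ≅ R')
    {β : S ≅ R} {β' : S' ≅ R'} (h₁ : r ≫ α'.hom = α.hom ≫ q) (h₂ : q ≫ ε'.hom = ε.hom ≫ t)
    (h₃ : β.inv ≫ u = t ≫ β'.inv) :
    r ≫ (α' ≪≫ ε' ≪≫ β'.symm).hom = (α ≪≫ ε ≪≫ β.symm).hom ≫ u := by
  simp [reassoc_of% h₁, reassoc_of% h₂, h₃]

end CategoryTheory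

section

universe v₁ v₂ v₃ u₁ u₂ u₃

variable {A : Type u₁} [Category.{v₁} A] [Abelian A]
  {B : Type u₂} [Category.{v₂} B] [Abelian B]
  {C : Type u₃} [Category.{v₃} C] [Abelian C]

namespace CategoryTheory.InjectiveResolution

variable {X : A} (I : InjectiveResolution X) (F : A ⥤ B) (G : B ⥤ C) [F.Additive] [G.Additive]
  [PreservesFiniteLimits F] [PreservesFiniteLimits G] [PreservesFiniteColimits F]

/-- The comparison morphisms between the images under an exact functor `F` of injective resolutions
and injective resolutions of the images are natural up to homotopy. -/
theorem exists_homotopy {Y : A} (f : X ⟶ Y) (I' : InjectiveResolution Y)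
    (J : InjectiveResolution (F.obj X)) (J' : InjectiveResolution (F.obj Y))
    (φ : (F.mapHomologicalComplex _).obj I.cocomplex ⟶ J.cocomplex)
    (hφ : F.map (I.ι.f 0) ≫ φ.f 0 = J.ι.f 0)
    (φ' : (F.mapHomologicalComplex _).obj I'.cocomplex ⟶ J'.cocomplex)
    (hφ' : F.map (I'.ι.f 0) ≫ φ'.f 0 = J'.ι.f 0)
    (a : I.cocomplex ⟶ I'.cocomplex) (ha : I.ι.f 0 ≫ a.f 0 = f ≫ I'.ι.f 0)
    (b : J.cocomplex ⟶ J'.cocomplex) (hb : J.ι.f 0 ≫ b.f 0 = F.map f ≫ J'.ι.f 0) :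
    Nonempty (Homotopy ((F.mapHomologicalComplex _).map a ≫ φ') (φ ≫ b)) := by
  refine CochainComplex.nonempty_homotopy_of_exact (I.exact₀_map F) (I.exact_succ_map F) _ _ ?_
  have h₁ : F.map (I.ι.f 0) ≫ F.map (a.f 0) = F.map f ≫ F.map (I'.ι.f 0) := by
    rw [← F.map_comp, ha]
    exact F.map_comp _ _
  have h₂ : F.map (I.ι.f 0) ≫ F.map (a.f 0) ≫ φ'.f 0 = J.ι.f 0 ≫ b.f 0 :=
    ((reassoc_of% h₁) (φ'.f 0)).trans <| (Category.assoc _ _ _).trans <|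
      (congrArg (F.map f ≫ ·) hφ').trans hb.symm
  exact h₂.trans ((congrArg (· ≫ b.f 0) hφ.symm).trans (Category.assoc _ _ _))

/-- If `F` is exact and sends injective objects to `G`-acyclic objects, then `G` preserves the
quasi-isomorphisms from the image under `F` of an injective resolution of `X` to an injective
resolution of `F.obj X` which are compatible with the coaugmentations. -/
theorem quasiIso_map_of_acyclic [EnoughInjectives B]
    (hF : ∀ I : A, Injective I → ∀ i : ℕ, 1 ≤ i → IsZero ((G.rightDerived i).obj (F.obj I)))
    (J : InjectiveResolution (F.obj X))
    (φ : (F.mapHomologicalComplex _).obj I.cocomplex ⟶ J.cocomplex)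
    (hφ : F.map (I.ι.f 0) ≫ φ.f 0 = J.ι.f 0) [QuasiIso φ] :
    QuasiIso ((G.mapHomologicalComplex _).map φ) :=
  CochainComplex.quasiIso_map_of_injective G φ
    (@CochainComplex.eq_zero_of_exact_of_mono _ _ _ _ _ _ _ _ (I.exact₀_map F) φ
      (have : Mono (J.ι.f 0) := inferInstance
       hφ ▸ this))
    fun n k ↦ hF _ (I.injective n) (k + 1) (by lia)

end CategoryTheory.InjectiveResolution

end

/-- **Grothendieck spectral sequence, easy case (exact `F`).**
Let `𝒜`, `ℬ`, `𝒞` be abelian categories such that `𝒜` and `ℬ` have enough injectives,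
and let `F : 𝒜 ⥤ ℬ` and `G : ℬ ⥤ 𝒞` be additive left exact functors.  If `F` is exact and
sends injective objects of `𝒜` to `G`-acyclic objects of `ℬ`, then for every `i ≥ 0` there
is a natural isomorphism `Rⁱ(G ∘ F)(A) ≅ RⁱG(F(A))`, naturally in `A`. -/
theorem easy_grothendieck_exact_first
    {𝒜 : Type*} [Category 𝒜] [Abelian 𝒜] [EnoughInjectives 𝒜]
    {ℬ : Type*} [Category ℬ] [Abelian ℬ] [EnoughInjectives ℬ]
    {𝒞 : Type*} [Category 𝒞] [Abelian 𝒞]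
    (F : 𝒜 ⥤ ℬ) (G : ℬ ⥤ 𝒞) [F.Additive] [G.Additive]
    [PreservesFiniteLimits F] [PreservesFiniteLimits G]
    [PreservesFiniteColimits F]
    (hacyclic : ∀ (I : 𝒜), Injective I → ∀ i : ℕ, 1 ≤ i →
      IsZero ((G.rightDerived i).obj (F.obj I)))
    (i : ℕ) :
    Nonempty ((F ⋙ G).rightDerived i ≅ F ⋙ G.rightDerived i) := by
  let I (X : 𝒜) := injectiveResolution X
  let J (X : 𝒜) := injectiveResolution (F.obj X)
  choose φ hφ hq using fun X ↦ (I X).exists_quasiIso_of_exact F (J X)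
  have hGφ (X : 𝒜) : QuasiIso ((G.mapHomologicalComplex _).map (φ X)) :=
    (I X).quasiIso_map_of_acyclic F G hacyclic (J X) (φ X) (hφ X)
  let e (X : 𝒜) := isoOfQuasiIsoAt ((G.mapHomologicalComplex _).map (φ X)) i
  refine ⟨NatIso.ofComponents (fun X ↦ (I X).isoRightDerivedObj (F ⋙ G) i ≪≫ e X ≪≫
    ((J X).isoRightDerivedObj G i).symm) fun {X Y} f ↦ ?_⟩
  let a : (I X).cocomplex ⟶ (I Y).cocomplex := InjectiveResolution.desc f _ _
  have ha : (I X).ι.f 0 ≫ a.f 0 = f ≫ (I Y).ι.f 0 :=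
    InjectiveResolution.desc_commutes_zero f (I Y) (I X)
  let b : (J X).cocomplex ⟶ (J Y).cocomplex := InjectiveResolution.desc (F.map f) _ _
  have hb : (J X).ι.f 0 ≫ b.f 0 = F.map f ≫ (J Y).ι.f 0 :=
    InjectiveResolution.desc_commutes_zero (F.map f) (J Y) (J X)
  obtain ⟨s⟩ := (I X).exists_homotopy F f (I Y) (J X) (J Y) (φ X) (hφ X) (φ Y) (hφ Y) a ha b hb
  have hs : HomologicalComplex.homologyMap (((F ⋙ G).mapHomologicalComplex _).map a) i ≫
      (e Y).hom =
      (e X).hom ≫ HomologicalComplex.homologyMap ((G.mapHomologicalComplex _).map b) i := by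
    have := (G.mapHomotopy s).homologyMap_eq i
    rw [Functor.map_comp, Functor.map_comp, HomologicalComplex.homologyMap_comp,
      HomologicalComplex.homologyMap_comp] at this
    exact this
  have h₁ := (I X).isoRightDerivedObj_hom_naturality f (I Y) a ha (F ⋙ G) i
  have h₂ := (J X).isoRightDerivedObj_inv_naturality (F.map f) (J Y) b hb G i
  exact isoTrans_naturality _ _ h₁ hs h₂
end

section
/- Let X be a taut locally spectral space and let S ⊆ X be a quasicompact subset. Then the closure of S in X is quasicompact. In particular, for every point x ∈ X the closure of {x} is quasicompact. -/
/-- A topological space is *spectral* if it is quasicompact, `T0`, sober, its quasicompact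
open subsets form a basis of the topology, and the intersection of any two quasicompact
open subsets is quasicompact. -/
def IsSpectralSpace (X : Type*) [TopologicalSpace X] : Prop :=
  CompactSpace X ∧ T0Space X ∧ QuasiSober X ∧
    TopologicalSpace.IsTopologicalBasis {U : Set X | IsOpen U ∧ IsCompact U} ∧
    ∀ U V : Set X, IsOpen U → IsCompact U → IsOpen V → IsCompact V → IsCompact (U ∩ V)

/-- A topological space is *locally spectral* if every point has an open neighbourhood
which is a spectral space in the subspace topology. -/
def LocallySpectralSpace (X : Type*) [TopologicalSpace X] : Prop :=
  ∀ x : X, ∃ U : Set X, IsOpen U ∧ x ∈ U ∧ IsSpectralSpace U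

/-- A locally spectral space is *taut* if it is quasiseparated and the closure of every
quasicompact open subset is quasicompact. -/
def TautSpace (X : Type*) [TopologicalSpace X] : Prop :=
  QuasiSeparatedSpace X ∧ ∀ U : Set X, IsOpen U → IsCompact U → IsCompact (closure U)

theorem LocallySpectralSpace.exists_isOpen_isCompact_superset
    {X : Type*} [TopologicalSpace X] (hls : LocallySpectralSpace X)
    {S : Set X} (hS : IsCompact S) :
    ∃ U : Set X, IsOpen U ∧ IsCompact U ∧ S ⊆ U := by
  refine hS.induction_on ⟨∅, isOpen_empty, isCompact_empty, subset_rfl⟩ ?_ ?_ ?_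
  · rintro s t hst ⟨U, hU, hUc, htU⟩
    exact ⟨U, hU, hUc, hst.trans htU⟩
  · rintro s t ⟨U, hU, hUc, hsU⟩ ⟨V, hV, hVc, htV⟩
    exact ⟨U ∪ V, hU.union hV, hUc.union hVc, Set.union_subset_union hsU htV⟩
  · intro x _
    obtain ⟨U, hU, hxU, hUs⟩ := hls x
    exact ⟨U, mem_nhdsWithin_of_mem_nhds (hU.mem_nhds hxU), U, hU,
      isCompact_iff_compactSpace.mpr hUs.1, subset_rfl⟩

theorem LocallySpectralSpace.isCompact_closure
    {X : Type*} [TopologicalSpace X] (hls : LocallySpectralSpace X) (htaut : TautSpace X)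
    {S : Set X} (hS : IsCompact S) : IsCompact (closure S) := by
  obtain ⟨U, hU, hUc, hSU⟩ := hls.exists_isOpen_isCompact_superset hS
  exact (htaut.2 U hU hUc).of_isClosed_subset isClosed_closure (closure_mono hSU)

/-- **Closures of quasicompact subsets of taut locally spectral spaces are quasicompact.**
Let `X` be a taut locally spectral space and `S ⊆ X` a quasicompact subset.  Then the
closure of `S` in `X` is quasicompact; in particular the closure of every singleton `{x}`
is quasicompact. -/
theorem isCompact_closure_of_taut_locallySpectral
    {X : Type*} [TopologicalSpace X]
    (hls : LocallySpectralSpace X) (htaut : TautSpace X)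
    (S : Set X) (hS : IsCompact S) :
    IsCompact (closure S) ∧ ∀ x : X, IsCompact (closure ({x} : Set X)) :=
  ⟨hls.isCompact_closure htaut hS, fun _ => hls.isCompact_closure htaut isCompact_singleton⟩
end

section
/- Let A be a commutative ring and let M be any A-module. Then M can be written as the direct limit (filtered colimit) of a directed system of finitely presented A-modules. -/
universe u v

section RelationSystem

variable {A κ P M : Type*} [CommRing A] [Preorder κ]
  [AddCommGroup P] [Module A P] [AddCommGroup M] [Module A M]

/-- Given a monotone family `F` of submodules of `P` and a linear map `π` on `P`, the pairs
consisting of an index `k` and a finitely generated submodule of `F k` that is killed by `π`. -/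
abbrev RelationSystem (F : κ →o Submodule A P) (π : P →ₗ[A] M) :=
  {p : κ × Submodule A P // p.2.FG ∧ p.2 ≤ F p.1 ∧ p.2 ≤ LinearMap.ker π}

namespace RelationSystem

variable {F : κ →o Submodule A P} {π : P →ₗ[A] M}

instance [IsDirectedOrder κ] : IsDirectedOrder (RelationSystem F π) where
  directed := by
    rintro ⟨⟨k, N⟩, hfg, hF, hπ⟩ ⟨⟨k', N'⟩, hfg', hF', hπ'⟩
    obtain ⟨l, hk, hk'⟩ := exists_ge_ge k k'
    exact ⟨⟨⟨l, N ⊔ N'⟩, hfg.sup hfg', sup_le (hF.trans (F.mono hk)) (hF'.trans (F.mono hk')),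
      sup_le hπ hπ'⟩, ⟨hk, le_sup_left⟩, ⟨hk', le_sup_right⟩⟩

instance [Nonempty κ] : Nonempty (RelationSystem F π) :=
  ⟨⟨⟨Classical.arbitrary κ, ⊥⟩, Submodule.fg_bot, bot_le, bot_le⟩⟩

/-- The quotient of `F k` by the given submodule. -/
abbrev quotient (i : RelationSystem F π) : Type _ :=
  F i.1.1 ⧸ i.1.2.submoduleOf (F i.1.1)

/-- The transition map between the quotients. -/
def transition (i j : RelationSystem F π) (h : i ≤ j) : i.quotient →ₗ[A] j.quotient :=
  Submodule.mapQ _ _ (Submodule.inclusion (F.mono h.1)) fun _ hx => h.2 hx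

instance : DirectedSystem (fun i : RelationSystem F π => i.quotient)
    (fun i j h => transition i j h) where
  map_self i x := by
    induction x using Submodule.Quotient.induction_on
    rfl
  map_map i j k _ _ x := by
    induction x using Submodule.Quotient.induction_on
    rfl

theorem finitePresentation_quotient (i : RelationSystem F π)
    [Module.FinitePresentation A (F i.1.1)] : Module.FinitePresentation A i.quotient := by
  refine Module.finitePresentation_of_surjective (i.1.2.submoduleOf (F i.1.1)).mkQ
    (Submodule.mkQ_surjective _) ?_
  rw [Submodule.ker_mkQ]
  refine Submodule.fg_of_fg_map_injective (F i.1.1).subtype Subtype.val_injective ?_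
  rw [Submodule.submoduleOf, Submodule.map_comap_subtype, inf_eq_right.mpr i.2.2.1]
  exact i.2.1

/-- The map induced by `π` on the quotients. -/
def toModule (i : RelationSystem F π) : i.quotient →ₗ[A] M :=
  (i.1.2.submoduleOf (F i.1.1)).liftQ (π ∘ₗ (F i.1.1).subtype) fun _ hx => i.2.2.2 hx

theorem toModule_transition (i j : RelationSystem F π) (h : i ≤ j) (x : i.quotient) :
    toModule j (transition i j h x) = toModule i x := by
  induction x using Submodule.Quotient.induction_on
  rfl

theorem exists_transition_eq_zero (i : RelationSystem F π) (x : i.quotient)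
    (hx : toModule i x = 0) : ∃ j, ∃ h : i ≤ j, transition i j h x = 0 := by
  induction x using Submodule.Quotient.induction_on with | _ p
  refine ⟨⟨⟨i.1.1, i.1.2 ⊔ Submodule.span A {(p : P)}⟩,
    i.2.1.sup (Submodule.fg_span_singleton _), sup_le i.2.2.1 ?_, sup_le i.2.2.2 ?_⟩,
    ⟨le_rfl, le_sup_left⟩, ?_⟩
  · exact (Submodule.span_singleton_le_iff_mem _ _).mpr p.2
  · exact (Submodule.span_singleton_le_iff_mem _ _).mpr hx
  · exact (Submodule.Quotient.mk_eq_zero _).mpr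
      (Submodule.mem_sup_right (Submodule.mem_span_singleton_self (p : P)))

/-- If every element of `M` is the image of an element of some `F k`, then `M` is the direct limit
of the quotients. -/
theorem bijective_lift_toModule [Nonempty κ] [IsDirectedOrder κ]
    [DecidableEq (RelationSystem F π)] (hπ : ∀ m, ∃ k, ∃ x ∈ F k, π x = m) :
    Function.Bijective (Module.DirectLimit.lift A (RelationSystem F π) quotient transition
      toModule toModule_transition) := by
  constructor
  · rw [injective_iff_map_eq_zero]
    intro z hz
    obtain ⟨i, x, rfl⟩ := Module.DirectLimit.exists_of z
    rw [Module.DirectLimit.lift_of] at hz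
    obtain ⟨j, h, hx⟩ := exists_transition_eq_zero i x hz
    rw [← Module.DirectLimit.of_f (hij := h), hx, map_zero]
  · intro m
    obtain ⟨k, x, hx, rfl⟩ := hπ m
    let i : RelationSystem F π := ⟨⟨k, ⊥⟩, Submodule.fg_bot, bot_le, bot_le⟩
    exact ⟨Module.DirectLimit.of A _ _ _ i (Submodule.Quotient.mk ⟨x, hx⟩),
      Module.DirectLimit.lift_of _ _ _⟩

end RelationSystem

end RelationSystem

theorem Submodule.finitePresentation_of_equiv_finsupp {A P ι : Type*} [CommRing A]
    [AddCommGroup P] [Module A P] [Finite ι] (F : Submodule A P) (e : F ≃ₗ[A] (ι →₀ A)) :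
    Module.FinitePresentation A F :=
  have : Module.FinitePresentation A (ι →₀ A) := Module.finitePresentation_of_projective A _
  .of_equiv e.symm

/-- **Every module is a direct limit of finitely presented modules.**
Let `A` be a commutative ring and `M` any `A`-module.  Then `M` can be written as the
direct limit (filtered colimit) of a directed system of finitely presented `A`-modules. -/
theorem exists_directedSystem_finitePresentation_directLimit_equiv
    (A : Type u) [CommRing A] (M : Type v) [AddCommGroup M] [Module A M] :
    ∃ (ι : Type (max u v)) (_ : Preorder ι) (_ : IsDirected ι (· ≤ ·)) (_ : DecidableEq ι)
      (G : ι → Type (max u v)) (_ : ∀ i, AddCommGroup (G i)) (_ : ∀ i, Module A (G i))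
      (f : ∀ i j, i ≤ j → G i →ₗ[A] G j),
      DirectedSystem G (fun i j h => f i j h) ∧
      (∀ i, Module.FinitePresentation A (G i)) ∧
      Nonempty (Module.DirectLimit G f ≃ₗ[A] M) := by
  classical
  let F : Finset M →o Submodule A (M →₀ A) :=
    ⟨fun s => Finsupp.supported A A (s : Set M),
      fun _ _ h => Finsupp.supported_mono (Finset.coe_subset.mpr h)⟩
  let π : (M →₀ A) →ₗ[A] M := Finsupp.linearCombination A id
  have hπ (m : M) : ∃ s, ∃ x ∈ F s, π x = m :=
    ⟨{m}, Finsupp.single m 1, Finsupp.single_mem_supported A 1 (by simp), by simp [π]⟩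
  have hF (s : Finset M) : Module.FinitePresentation A (F s) :=
    (F s).finitePresentation_of_equiv_finsupp (Finsupp.supportedEquivFinsupp (s : Set M))
  exact ⟨RelationSystem F π, inferInstance, inferInstance, inferInstance,
    RelationSystem.quotient, inferInstance, inferInstance, RelationSystem.transition,
    inferInstance, fun i => i.finitePresentation_quotient,
    ⟨LinearEquiv.ofBijective _ (RelationSystem.bijective_lift_toModule hπ)⟩⟩
end
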